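/- Let X be a compact metric space and f : X → X a continuous map. Then X is the disjoint union of the sets W^s(C) over all chain components C of f (that is, every x ∈ X belongs to W^s(C) for exactly one chain component C), and W^s(C) is a G_δ-subset of X for every chain component C. -/

import Mathlib

open Filter Metric Set Topology

section Defs

variable {X : Type*} [MetricSpace X]

/-- A δ-chain of `f` of length `k` (with `k ≥ 1`) within the set `C`, from `x` to `y`. -/
def ChainIn (f : X → X) (C : Set X) (δ : ℝ) (k : ℕ) (x y : X) : Prop :=
  1 ≤ k ∧ ∃ c : ℕ → X, c 0 = x ∧ c k = y ∧ (∀ i ≤ k, c i ∈ C) ∧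
    ∀ i < k, dist (f (c i)) (c (i + 1)) ≤ δ

/-- `x → y` : for every `δ > 0` there is a `δ`-chain of `f` from `x` to `y`. -/
def ChainReach (f : X → X) (x y : X) : Prop :=
  ∀ δ > 0, ∃ k, ChainIn f Set.univ δ k x y

/-- `x` is chain recurrent for `f`. -/
def ChainRecurrent (f : X → X) (x : X) : Prop := ChainReach f x x

/-- `C` is a chain component of `f`: an equivalence class of the relation `↔`
on the set of chain recurrent points. -/
def IsChainComponent (f : X → X) (C : Set X) : Prop :=
  ∃ x, ChainRecurrent f x ∧
    C = {y | ChainRecurrent f y ∧ ChainReach f x y ∧ ChainReach f y x}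

/-- The set of lengths of δ-cycles of `f` restricted to `C`. -/
def cycleLengths (f : X → X) (C : Set X) (δ : ℝ) : Set ℕ :=
  {k | ∃ x ∈ C, ChainIn f C δ k x x}

/-- The greatest common divisor of a set of natural numbers
(the greatest natural number dividing every element). -/
noncomputable def setGcd (S : Set ℕ) : ℕ := sSup {d | ∀ k ∈ S, d ∣ k}

/-- `x ∼_{C,δ} y` : there is a δ-chain of `f|_C` from `x` to `y` whose length is
divisible by `m(C,δ)`, the gcd of the lengths of all δ-cycles of `f|_C`. -/
def SimCd (f : X → X) (C : Set X) (δ : ℝ) (x y : X) : Prop :=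
  ∃ k, setGcd (cycleLengths f C δ) ∣ k ∧ ChainIn f C δ k x y

/-- `x ∼_C y` : `x ∼_{C,δ} y` for all `δ > 0`. -/
def SimC (f : X → X) (C : Set X) (x y : X) : Prop :=
  ∀ δ > 0, SimCd f C δ x y

/-- `𝒟(C,δ)` : the set of equivalence classes of `∼_{C,δ}`. -/
def DClassesd (f : X → X) (C : Set X) (δ : ℝ) : Set (Set X) :=
  {D | ∃ x ∈ C, D = {y ∈ C | SimCd f C δ x y}}

/-- `𝒟(C)` : the set of equivalence classes of `∼_C`. -/
def DClasses (f : X → X) (C : Set X) : Set (Set X) :=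
  {D | ∃ x ∈ C, D = {y ∈ C | SimC f C x y}}

/-- `W^s(C) = {x : lim_{i→∞} d(f^i(x), C) = 0}`. -/
def wStable (f : X → X) (C : Set X) : Set X :=
  {x | Tendsto (fun i => infDist (f^[i] x) C) atTop (nhds 0)}

/-- `V^s(D) = ⋂_{δ>0} {x ∈ W^s(C) : lim_{i→∞} d(f^i(x), f^i(D_δ)) = 0}`, where
`D_δ` is the unique element of `𝒟(C,δ)` containing `D`. -/
def vStable (f : X → X) (C D : Set X) : Set X :=
  {x | x ∈ wStable f C ∧ ∀ δ > 0, ∀ Dd ∈ DClassesd f C δ, D ⊆ Dd →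
    Tendsto (fun i => infDist (f^[i] x) (f^[i] '' Dd)) atTop (nhds 0)}

/-- The s-limit shadowing property. -/
def SLimitShadowing (f : X → X) : Prop :=
  ∀ ε > 0, ∃ δ > 0, ∀ x : ℕ → X,
    (∀ i, dist (f (x i)) (x (i + 1)) ≤ δ) →
    Tendsto (fun i => dist (f (x i)) (x (i + 1))) atTop (nhds 0) →
    ∃ z : X, (∀ i, dist (f^[i] z) (x i) ≤ ε) ∧
      Tendsto (fun i => dist (f^[i] z) (x i)) atTop (nhds 0)

/-- The limit shadowing property. -/
def LimitShadowing (f : X → X) : Prop :=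
  ∀ x : ℕ → X, Tendsto (fun i => dist (f (x i)) (x (i + 1))) atTop (nhds 0) →
    ∃ z : X, Tendsto (fun i => dist (f^[i] z) (x i)) atTop (nhds 0)

/-- The (plain) shadowing property. -/
def ShadowingProperty (f : X → X) : Prop :=
  ∀ ε > 0, ∃ δ > 0, ∀ x : ℕ → X, (∀ i, dist (f (x i)) (x (i + 1)) ≤ δ) →
    ∃ z : X, ∀ i, dist (f^[i] z) (x i) ≤ ε

/-- A Furstenberg family: hereditary upward and proper. -/
def FurstenbergFamily (F : Set (Set ℕ)) : Prop :=
  (∀ A B : Set ℕ, A ∈ F → A ⊆ B → B ∈ F) ∧ F.Nonempty ∧ F ≠ Set.univ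

/-- A full Furstenberg family. -/
def FullFamily (F : Set (Set ℕ)) : Prop :=
  ∀ A ∈ F, ∀ n : ℕ, {i ∈ A | n ≤ i} ∈ F

/-- A translation invariant Furstenberg family. -/
def TranslationInvariantFamily (F : Set (Set ℕ)) : Prop :=
  ∀ A ∈ F, ∀ n : ℕ, ((fun i => i + n) '' A ∈ F ∧ {i | i + n ∈ A} ∈ F)

/-- `S_f(x₁,…,xₙ; r) = {i : min_{j<k} d(fⁱ(x_j), fⁱ(x_k)) > r}`. -/
def Sset (f : X → X) {n : ℕ} (x : Fin n → X) (r : ℝ) : Set ℕ :=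
  {i | ∀ j k : Fin n, j < k → r < dist (f^[i] (x j)) (f^[i] (x k))}

/-- `T_f(x₁,…,xₙ; r) = {i : max_{j<k} d(fⁱ(x_j), fⁱ(x_k)) < r}`. -/
def Tset (f : X → X) {n : ℕ} (x : Fin n → X) (r : ℝ) : Set ℕ :=
  {i | ∀ j k : Fin n, j < k → dist (f^[i] (x j)) (f^[i] (x k)) < r}

/-- `(x₁,…,xₙ)` is an `(ℱ,𝒢)`-δ-scrambled n-tuple for `f`. -/
def Scrambled (f : X → X) (F G : Set (Set ℕ)) (δ : ℝ) {n : ℕ} (x : Fin n → X) : Prop :=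
  Sset f x δ ∈ F ∧ ∀ ε > 0, Tset f x ε ∈ G

/-- `Y` is dense `(ℱ,𝒢)`-n-δ-chaotic for `f`: the `(ℱ,𝒢)`-δ-scrambled n-tuples in `Yⁿ`
form a dense subset of `Yⁿ`. -/
def DenseChaotic (f : X → X) (F G : Set (Set ℕ)) (n : ℕ) (δ : ℝ) (Y : Set X) : Prop :=
  {x : Fin n → X | ∀ j, x j ∈ Y} ⊆
    closure {x : Fin n → X | (∀ j, x j ∈ Y) ∧ Scrambled f F G δ x}

/-- `S` is a residual subset of the subspace `T`: it contains a countable intersection of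
dense open subsets of `T`. -/
def ResidualIn {α : Type*} [TopologicalSpace α] (T S : Set α) : Prop :=
  ∃ U : ℕ → Set α, (∀ i, IsOpen (U i)) ∧ (∀ i, T ⊆ closure (U i ∩ T)) ∧
    (⋂ i, U i) ∩ T ⊆ S

/-- `Y` is generic `(ℱ,𝒢)`-n-δ-chaotic for `f`: the `(ℱ,𝒢)`-δ-scrambled n-tuples in `Yⁿ`
form a residual subset of `Yⁿ`. -/
def GenericChaotic (f : X → X) (F G : Set (Set ℕ)) (n : ℕ) (δ : ℝ) (Y : Set X) : Prop :=
  ResidualIn {x : Fin n → X | ∀ j, x j ∈ Y}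
    {x : Fin n → X | (∀ j, x j ∈ Y) ∧ Scrambled f F G δ x}

/-- A Furstenberg family `F` is compatible with `(Z, g)`. -/
def CompatibleFamily {Z : Type*} [TopologicalSpace Z] (F : Set (Set ℕ)) (g : Z → Z) : Prop :=
  ∀ U : Set Z, IsOpen U → IsGδ {z | {i | g^[i] z ∈ U} ∈ F}

end Defs

section ChainRelation

variable {X : Type*} [MetricSpace X] {f : X → X}

/-- `δ`-chains are the transitive closure of the relation `d(f(x), y) ≤ δ`. -/
lemma exists_chainIn_univ_iff_transGen {δ : ℝ} {x y : X} :
    (∃ k, ChainIn f Set.univ δ k x y) ↔ Relation.TransGen (fun a b => dist (f a) b ≤ δ) x y := by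
  constructor
  · rintro ⟨k, hk, c, rfl, rfl, -, hc⟩
    induction k, hk using Nat.le_induction with
    | base => exact .single (hc 0 one_pos)
    | succ k hk ih => exact (ih fun i hi => hc i (by omega)).tail (hc k (by omega))
  · intro h
    induction h with
    | @single b h =>
      refine ⟨1, le_rfl, fun i => if i = 0 then x else b, by simp, by simp, by simp, ?_⟩
      intro i hi
      obtain rfl : i = 0 := by omega
      simpa using h
    | @tail b z _ hbz ih =>
      obtain ⟨k, hk, c, hc0, hck, -, hc⟩ := ih
      refine ⟨k + 1, by omega, fun i => if i ≤ k then c i else z, by simp [hc0], by simp,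
        by simp, ?_⟩
      intro i hi
      rcases (Nat.lt_succ_iff_lt_or_eq.mp hi) with h | rfl
      · simpa [h.le, Nat.succ_le_of_lt h] using hc i h
      · simpa [hck] using hbz

lemma chainReach_iff_transGen {x y : X} :
    ChainReach f x y ↔ ∀ δ > 0, Relation.TransGen (fun a b => dist (f a) b ≤ δ) x y :=
  forall₂_congr fun _ _ => exists_chainIn_univ_iff_transGen

lemma ChainReach.trans {x y z : X} (hxy : ChainReach f x y) (hyz : ChainReach f y z) :
    ChainReach f x z := by
  rw [chainReach_iff_transGen] at *
  exact fun δ hδ => (hxy δ hδ).trans (hyz δ hδ)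

lemma isClosed_setOf_chainReach_right (x : X) : IsClosed {y | ChainReach f x y} := by
  refine isClosed_of_closure_subset fun y hy => chainReach_iff_transGen.2 fun δ hδ => ?_
  obtain ⟨z, hz, hyz⟩ := Metric.mem_closure_iff.1 hy (δ / 2) (half_pos hδ)
  obtain ⟨b, hb, hbz⟩ := Relation.TransGen.tail'_iff.1
    (chainReach_iff_transGen.1 hz (δ / 2) (half_pos hδ))
  refine Relation.TransGen.tail'_iff.2 ⟨b, Relation.ReflTransGen.mono (fun u v h => by linarith) _ _ hb, ?_⟩
  linarith [dist_triangle_right (f b) y z]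

lemma isClosed_setOf_chainReach_left (hf : Continuous f) (x : X) :
    IsClosed {y | ChainReach f y x} := by
  refine isClosed_of_closure_subset fun y hy => chainReach_iff_transGen.2 fun δ hδ => ?_
  obtain ⟨η, hη, hfη⟩ := Metric.continuous_iff.1 hf y (δ / 2) (half_pos hδ)
  obtain ⟨z, hz, hyz⟩ := Metric.mem_closure_iff.1 hy η hη
  obtain ⟨b, hzb, hb⟩ := Relation.TransGen.head'_iff.1
    (chainReach_iff_transGen.1 hz (δ / 2) (half_pos hδ))
  refine Relation.TransGen.head'_iff.2 ⟨b, ?_, Relation.ReflTransGen.mono (fun u v h => by linarith) _ _ hb⟩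
  have := hfη z (by rwa [dist_comm])
  linarith [dist_triangle_left (f y) b (f z)]

lemma reflTransGen_iterate {δ : ℝ} (hδ : 0 ≤ δ) (x : X) {m n : ℕ} (h : m ≤ n) :
    Relation.ReflTransGen (fun a b => dist (f a) b ≤ δ) (f^[m] x) (f^[n] x) := by
  induction n, h using Nat.le_induction with
  | base => exact .refl
  | succ n _ ih => exact ih.tail (by simpa [Function.iterate_succ_apply'] using hδ)

/-- Any two points of an ω-limit set are related by chains. -/
lemma ChainReach.of_mapClusterPt (hf : Continuous f) {x y z : X}
    (hy : MapClusterPt y atTop fun i => f^[i] x) (hz : MapClusterPt z atTop fun i => f^[i] x) :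
    ChainReach f y z := by
  refine chainReach_iff_transGen.2 fun δ hδ => ?_
  obtain ⟨η, hη, hfη⟩ := Metric.continuous_iff.1 hf y δ hδ
  obtain ⟨n, hn⟩ := (hy.frequently (Metric.ball_mem_nhds y hη)).exists
  obtain ⟨m, hm, hnm⟩ := ((hz.frequently (Metric.ball_mem_nhds z hδ)).and_eventually
    (eventually_ge_atTop (n + 2))).exists
  obtain ⟨m, rfl⟩ : ∃ k, m = k + 1 := ⟨m - 1, by omega⟩
  have hfirst : dist (f y) (f^[n + 1] x) ≤ δ := by
    rw [Function.iterate_succ_apply', dist_comm]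
    exact (hfη _ hn).le
  have hlast : dist (f (f^[m] x)) z ≤ δ := by
    rw [← Function.iterate_succ_apply' f]
    exact (Metric.mem_ball.1 hm).le
  exact Relation.TransGen.head' hfirst
    ((reflTransGen_iterate hδ.le x (by omega : n + 1 ≤ m)).tail hlast)

end ChainRelation

namespace IsChainComponent

variable {X : Type*} [MetricSpace X] {f : X → X} {C D : Set X}

lemma eq_setOf_of_mem (hC : IsChainComponent f C) {y : X} (hy : y ∈ C) :
    C = {z | ChainReach f y z ∧ ChainReach f z y} := by
  obtain ⟨x, -, rfl⟩ := hC
  obtain ⟨-, hxy, hyx⟩ := hy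
  ext z
  exact ⟨fun ⟨_, hxz, hzx⟩ => ⟨hyx.trans hxz, hzx.trans hxy⟩,
    fun ⟨hyz, hzy⟩ => ⟨hzy.trans hyz, hxy.trans hyz, hzy.trans hyx⟩⟩

lemma nonempty (hC : IsChainComponent f C) : C.Nonempty := by
  obtain ⟨x, hx, rfl⟩ := hC
  exact ⟨x, hx, hx, hx⟩

lemma eq_of_mem (hC : IsChainComponent f C) (hD : IsChainComponent f D) {y : X}
    (hyC : y ∈ C) (hyD : y ∈ D) : C = D := by
  rw [hC.eq_setOf_of_mem hyC, hD.eq_setOf_of_mem hyD]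

lemma isClosed (hf : Continuous f) (hC : IsChainComponent f C) : IsClosed C := by
  obtain ⟨y, hy⟩ := hC.nonempty
  rw [hC.eq_setOf_of_mem hy]
  exact (isClosed_setOf_chainReach_right y).inter (isClosed_setOf_chainReach_left hf y)

variable [CompactSpace X]

lemma mem_wStable_of_mapClusterPt (hf : Continuous f) (hC : IsChainComponent f C) {x y : X}
    (hyC : y ∈ C) (hy : MapClusterPt y atTop fun i => f^[i] x) : x ∈ wStable f C := by
  refine Metric.tendsto_atTop'.2 fun ε hε => ?_
  by_contra! hfar
  have hfreq : ∃ᶠ i in atTop, f^[i] x ∈ {z | ε ≤ infDist z C} := by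
    rw [frequently_atTop']
    intro N
    obtain ⟨i, hi, hdist⟩ := hfar N
    rw [Real.dist_0_eq_abs, abs_of_nonneg infDist_nonneg] at hdist
    exact ⟨i, hi, hdist⟩
  obtain ⟨z, hzε, hz⟩ := (isClosed_le continuous_const
    (continuous_infDist_pt C)).isCompact.exists_mapClusterPt_of_frequently hfreq
  have hzC : z ∈ C := by
    rw [hC.eq_setOf_of_mem hyC]
    exact ⟨.of_mapClusterPt hf hy hz, .of_mapClusterPt hf hz hy⟩
  have : ε ≤ infDist z C := hzε
  rw [infDist_zero_of_mem hzC] at this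
  exact this.not_gt hε

lemma exists_mapClusterPt_of_frequently (hf : Continuous f) (hC : IsChainComponent f C) {x : X}
    (h : ∀ n : ℕ, ∃ᶠ i in atTop, infDist (f^[i] x) C < 1 / (n + 1 : ℝ)) :
    ∃ y ∈ C, MapClusterPt y atTop fun i => f^[i] x := by
  obtain ⟨φ, hφ, hφC⟩ := extraction_forall_of_frequently h
  obtain ⟨y, ψ, hψ, hy⟩ := CompactSpace.tendsto_subseq fun k => f^[φ k] x
  have hlim : Tendsto (fun k => infDist (f^[φ k] x) C) atTop (𝓝 0) :=
    squeeze_zero (fun _ => infDist_nonneg) (fun k => (hφC k).le)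
      tendsto_one_div_add_atTop_nhds_zero_nat
  have hzero : infDist y C = 0 := tendsto_nhds_unique
    (((continuous_infDist_pt C).tendsto y).comp hy) (hlim.comp hψ.tendsto_atTop)
  exact ⟨y, ((hC.isClosed hf).mem_iff_infDist_zero hC.nonempty).2 hzero,
    hy.mapClusterPt.of_comp (φ := φ ∘ ψ) (hφ.comp hψ).tendsto_atTop⟩

lemma mem_wStable_iff_frequently (hf : Continuous f) (hC : IsChainComponent f C) {x : X} :
    x ∈ wStable f C ↔ ∀ n : ℕ, ∃ᶠ i in atTop, infDist (f^[i] x) C < 1 / (n + 1 : ℝ) := by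
  refine ⟨fun hx n => (hx.eventually_lt_const (by positivity)).frequently, fun h => ?_⟩
  obtain ⟨y, hyC, hy⟩ := hC.exists_mapClusterPt_of_frequently hf h
  exact hC.mem_wStable_of_mapClusterPt hf hyC hy

lemma mem_of_mapClusterPt (hf : Continuous f) (hC : IsChainComponent f C) {x y : X}
    (hx : x ∈ wStable f C) (hy : MapClusterPt y atTop fun i => f^[i] x) : y ∈ C := by
  obtain ⟨z, hzC, hz⟩ := hC.exists_mapClusterPt_of_frequently hf
    ((hC.mem_wStable_iff_frequently hf).1 hx)
  rw [hC.eq_setOf_of_mem hzC]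
  exact ⟨.of_mapClusterPt hf hz hy, .of_mapClusterPt hf hy hz⟩

lemma isGδ_wStable (hf : Continuous f) (hC : IsChainComponent f C) : IsGδ (wStable f C) := by
  have hEq : wStable f C =
      ⋂ (n : ℕ) (N : ℕ), ⋃ i ≥ N, {x | infDist (f^[i] x) C < 1 / (n + 1 : ℝ)} := by
    ext x
    simp [hC.mem_wStable_iff_frequently hf, frequently_atTop]
  rw [hEq]
  refine .iInter fun n => .iInter fun N => IsOpen.isGδ ?_
  exact isOpen_biUnion fun i _ =>
    isOpen_lt ((continuous_infDist_pt C).comp (hf.iterate i)) continuous_const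

end IsChainComponent

/-- Lemma 2.1: `X` is the disjoint union of the basins `W^s(C)` over the chain
components `C` of `f`, and each `W^s(C)` is a `G_δ`-subset of `X`. -/
theorem wStable_partition_and_Gdelta
    {X : Type*} [MetricSpace X] [CompactSpace X] (f : X → X) (hf : Continuous f) :
    (∀ x : X, ∃! C : Set X, IsChainComponent f C ∧ x ∈ wStable f C) ∧
    (∀ C : Set X, IsChainComponent f C → IsGδ (wStable f C)) := by
  refine ⟨fun x => ?_, fun C hC => hC.isGδ_wStable hf⟩
  obtain ⟨y, -, hy⟩ := isCompact_univ.exists_mapClusterPt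
    (f := atTop) (u := fun i => f^[i] x) (by simp)
  have hyy : ChainReach f y y := .of_mapClusterPt hf hy hy
  have hC : IsChainComponent f
      {z | ChainRecurrent f z ∧ ChainReach f y z ∧ ChainReach f z y} := ⟨y, hyy, rfl⟩
  refine ⟨_, ⟨hC, hC.mem_wStable_of_mapClusterPt hf ⟨hyy, hyy, hyy⟩ hy⟩, ?_⟩
  rintro D ⟨hD, hxD⟩
  exact hD.eq_of_mem hC (hD.mem_of_mapClusterPt hf hxD hy) ⟨hyy, hyy, hyy⟩
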